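/- There exist functions H̄₊, H̄₋, Ĥ : ℝ^d → ℝ, a constant H̄* ∈ ℝ, and an event Ω̂ ∈ 𝓕 of full probability such that for every ω ∈ Ω̂ and every p ∈ ℝ^d: H̄₊(p,ω) = H̄₊(p), H̄₋(p,ω) = H̄₋(p), Ĥ(p,ω) = Ĥ(p) and H̄*(ω) = H̄*. -/

import Mathlib

open MeasureTheory Filter Topology Bornology
open scoped RealInnerProductSpace NNReal

noncomputable section

/-- Euclidean space ℝ^d. -/
abbrev Ed (d : ℕ) := EuclideanSpace ℝ (Fin d)

/-- The set 𝓛 of globally Lipschitz real-valued functions on ℝ^d. -/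
def LipFuns (d : ℕ) : Set (Ed d → ℝ) := {w | ∃ C : ℝ≥0, LipschitzWith C w}

/-- SL⁺ : Lipschitz functions sublinear from below, i.e. liminf_{|y|→∞} w(y)/|y| ≥ 0. -/
def SLplus (d : ℕ) : Set (Ed d → ℝ) :=
  {w | w ∈ LipFuns d ∧ ∀ ε : ℝ, 0 < ε → ∃ R : ℝ, ∀ y : Ed d, R ≤ ‖y‖ → -ε ≤ w y / ‖y‖}

/-- SL⁻ : Lipschitz functions sublinear from above, i.e. limsup_{|y|→∞} w(y)/|y| ≤ 0. -/
def SLminus (d : ℕ) : Set (Ed d → ℝ) :=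
  {w | w ∈ LipFuns d ∧ ∀ ε : ℝ, 0 < ε → ∃ R : ℝ, ∀ y : Ed d, R ≤ ‖y‖ → w y / ‖y‖ ≤ ε}

/-- 𝓢 : Lipschitz functions strictly sublinear at infinity. -/
def Scal (d : ℕ) : Set (Ed d → ℝ) := SLplus d ∩ SLminus d

/-- H̄₊(p) = inf_{w ∈ SL⁺} esssup_y H(p + Dw(y), y). -/
def HbarPlus (d : ℕ) (H : Ed d → Ed d → ℝ) (p : Ed d) : ℝ :=
  sInf {t | ∃ w ∈ SLplus d, t = essSup (fun y => H (p + gradient w y) y) volume}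

/-- H̄₋(p) = inf_{w ∈ SL⁻} esssup_y H(p + Dw(y), y). -/
def HbarMinus (d : ℕ) (H : Ed d → Ed d → ℝ) (p : Ed d) : ℝ :=
  sInf {t | ∃ w ∈ SLminus d, t = essSup (fun y => H (p + gradient w y) y) volume}

/-- Ĥ(p) = inf_{w ∈ 𝓢} esssup_y H(p + Dw(y), y). -/
def Hhat (d : ℕ) (H : Ed d → Ed d → ℝ) (p : Ed d) : ℝ :=
  sInf {t | ∃ w ∈ Scal d, t = essSup (fun y => H (p + gradient w y) y) volume}

/-- H̄* = inf_{w ∈ 𝓛} esssup_y H(Dw(y), y). -/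
def Hstar (d : ℕ) (H : Ed d → Ed d → ℝ) : ℝ :=
  sInf {t | ∃ w ∈ LipFuns d, t = essSup (fun y => H (gradient w y) y) volume}

/-- m_μ(y,x) = sup { w(y) − w(x) : w ∈ 𝓛, H(Dw,z) ≤ μ a.e. }. -/
def mMu (d : ℕ) (H : Ed d → Ed d → ℝ) (μ : ℝ) (y x : Ed d) : ℝ :=
  sSup {t | ∃ w ∈ LipFuns d, (∀ᵐ z ∂volume, H (gradient w z) z ≤ μ) ∧ t = w y - w x}

/-- Viscosity subsolution of F(Du, y) ≤ μ in U. -/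
def ViscSub (d : ℕ) (F : Ed d → Ed d → ℝ) (μ : ℝ) (U : Set (Ed d)) (u : Ed d → ℝ) : Prop :=
  ∀ (φ : Ed d → ℝ) (x₀ : Ed d), x₀ ∈ U → ContDiffAt ℝ 1 φ x₀ →
    IsLocalMaxOn (fun y => u y - φ y) U x₀ → F (gradient φ x₀) x₀ ≤ μ

/-- Viscosity supersolution of F(Dv, y) ≥ μ in U. -/
def ViscSuper (d : ℕ) (F : Ed d → Ed d → ℝ) (μ : ℝ) (U : Set (Ed d)) (v : Ed d → ℝ) : Prop :=
  ∀ (φ : Ed d → ℝ) (x₀ : Ed d), x₀ ∈ U → ContDiffAt ℝ 1 φ x₀ →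
    IsLocalMinOn (fun y => v y - φ y) U x₀ → μ ≤ F (gradient φ x₀) x₀ 

/-- ω-dependent H̄₊. -/
def HbarPlusOm (d : ℕ) {Ω : Type*} (H : Ed d → Ed d → Ω → ℝ) (p : Ed d) (ω : Ω) : ℝ :=
  sInf {t | ∃ w ∈ SLplus d, t = essSup (fun y => H (p + gradient w y) y ω) volume}

/-- ω-dependent H̄₋. -/
def HbarMinusOm (d : ℕ) {Ω : Type*} (H : Ed d → Ed d → Ω → ℝ) (p : Ed d) (ω : Ω) : ℝ :=
  sInf {t | ∃ w ∈ SLminus d, t = essSup (fun y => H (p + gradient w y) y ω) volume}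

/-- ω-dependent Ĥ. -/
def HhatOm (d : ℕ) {Ω : Type*} (H : Ed d → Ed d → Ω → ℝ) (p : Ed d) (ω : Ω) : ℝ :=
  sInf {t | ∃ w ∈ Scal d, t = essSup (fun y => H (p + gradient w y) y ω) volume}

/-- ω-dependent H̄*. -/
def HstarOm (d : ℕ) {Ω : Type*} (H : Ed d → Ed d → Ω → ℝ) (ω : Ω) : ℝ :=
  sInf {t | ∃ w ∈ LipFuns d, t = essSup (fun y => H (gradient w y) y ω) volume}

/-- ω-dependent metric problem solution m_μ(y,x,ω). -/
def mMuOm (d : ℕ) {Ω : Type*} (H : Ed d → Ed d → Ω → ℝ) (μ : ℝ) (y x : Ed d) (ω : Ω) : ℝ :=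
  sSup {t | ∃ w ∈ LipFuns d, (∀ᵐ z ∂volume, H (gradient w z) z ω ≤ μ) ∧ t = w y - w x}

open Set in
lemma meas_closed {d : ℕ} {Ω : Type*} [MeasurableSpace Ω] (G : Ω → C(Ed d × Ed d, ℝ))
    (hG : ∀ z, Measurable fun ω => G ω z) (B : Set C(Ed d × Ed d, ℝ)) (hB : IsClosed B) :
    MeasurableSet (G ⁻¹' B) := by
  have key : @Measurable _ _ _ (borel C(Ed d × Ed d, ℝ)) G := by
    rw [borel_eq_generateFrom_of_subbasis (ContinuousMap.compactOpen_eq)]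
    refine measurable_generateFrom ?_
    rintro _ ⟨K, hK, U, hU, rfl⟩
    have hK' : IsCompact K := hK
    have hU' : IsOpen U := hU
    obtain ⟨D, hDK, hDc, hDd⟩ := TopologicalSpace.IsSeparable.exists_countable_dense_subset
      (TopologicalSpace.IsSeparable.of_separableSpace K)
    have : (G ⁻¹' {f | MapsTo f K U}) =
        ⋃ n : ℕ, ⋂ z ∈ D, {ω | ((n : ENNReal) + 1)⁻¹ ≤ Metric.infEDist (G ω z) Uᶜ} := by
      ext ω
      simp only [mem_preimage, mem_iUnion, mem_iInter]
      have hcont : Continuous fun z => Metric.infEDist (G ω z) Uᶜ :=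
        Metric.continuous_infEDist.comp (G ω).continuous
      constructor
      · intro h
        have h : MapsTo (G ω) K U := h
        rcases K.eq_empty_or_nonempty with hKe | hKn
        · refine ⟨0, fun z hz => ?_⟩
          have := hDK hz
          simp [hKe] at this
        · obtain ⟨z0, hz0, hmin⟩ := hK'.exists_isMinOn hKn hcont.continuousOn
          have hpos : Metric.infEDist (G ω z0) Uᶜ ≠ 0 := by
            intro h0
            have := (Metric.mem_iff_infEDist_zero_of_closed hU'.isClosed_compl).2 h0
            exact this (h hz0)
          obtain ⟨n, hn⟩ := ENNReal.exists_inv_nat_lt hpos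
          refine ⟨n, fun z hz => ?_⟩
          have h1 : Metric.infEDist (G ω z0) Uᶜ ≤ Metric.infEDist (G ω z) Uᶜ := hmin (hDK hz)
          refine le_trans ?_ h1
          refine le_trans ?_ hn.le
          exact ENNReal.inv_le_inv.2 le_self_add
      · rintro ⟨n, hn⟩ z hz
        have hcl : IsClosed {z | ((n : ENNReal) + 1)⁻¹ ≤ Metric.infEDist (G ω z) Uᶜ} :=
          isClosed_le continuous_const hcont
        have : z ∈ {z | ((n : ENNReal) + 1)⁻¹ ≤ Metric.infEDist (G ω z) Uᶜ} :=
          hcl.closure_subset_iff.2 (fun z hz => hn z hz) (hDd hz)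
        by_contra hzU
        have h0 : Metric.infEDist (G ω z) Uᶜ = 0 := Metric.infEDist_zero_of_mem hzU
        have h1 : ((n : ENNReal) + 1)⁻¹ ≤ Metric.infEDist (G ω z) Uᶜ := this
        rw [h0] at h1
        simp at h1
    rw [this]
    refine MeasurableSet.iUnion fun n => MeasurableSet.biInter hDc fun z _ => ?_
    exact measurableSet_le measurable_const (Metric.continuous_infEDist.measurable.comp (hG z))
  let _ : MeasurableSpace C(Ed d × Ed d, ℝ) := borel _
  have : BorelSpace C(Ed d × Ed d, ℝ) := ⟨rfl⟩
  exact key hB.measurableSet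

open Set in
lemma line_bound {d : ℕ} {w : Ed d → ℝ} {L : ℝ≥0} (hw : LipschitzWith L w)
    {U : Set (Ed d)} (hU : IsOpen U) (hUc : Convex ℝ U) {v : Ed d} {M : ℝ}
    (h : ∀ᵐ y, y ∈ U → ⟪gradient w y, v⟫ ≤ M) {x : Ed d} (hx : x ∈ U) (hxv : x + v ∈ U) :
    w (x + v) - w x ≤ M := by
  -- good points
  have hgood : ∀ᵐ y, DifferentiableAt ℝ w y ∧ (y ∈ U → ⟪gradient w y, v⟫ ≤ M) :=
    (hw.ae_differentiableAt).and h
  obtain ⟨N, hNsub, hNm, hN0⟩ := exists_measurable_superset_of_null (ae_iff.1 hgood)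
  have hN : ∀ y, y ∉ N → DifferentiableAt ℝ w y ∧ (y ∈ U → ⟪gradient w y, v⟫ ≤ M) := by
    intro y hy
    by_contra hc
    exact hy (hNsub hc)
  have hae : ∀ᵐ z : Ed d, ∀ᵐ t : ℝ, z + t • v ∉ N := by
    have hm : MeasurableSet {q : ℝ × Ed d | q.2 + q.1 • v ∉ N} := by
      have : Measurable fun q : ℝ × Ed d => q.2 + q.1 • v := by fun_prop
      exact this hNm.compl
    refine (Measure.ae_ae_comm (p := fun (t : ℝ) (z : Ed d) => z + t • v ∉ N) hm).1 ?_
    refine Filter.Eventually.of_forall fun t => ?_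
    have hmp := (measurePreserving_add_right (volume : Measure (Ed d)) (t • v))
    exact hmp.quasiMeasurePreserving.ae (measure_eq_zero_iff_ae_notMem.1 hN0)
  have hz : ∀ᵐ z : Ed d, z ∈ U → z + v ∈ U → w (z + v) - w z ≤ M := by
    filter_upwards [hae] with z hz hzU hzvU
    have hLip : LipschitzWith (L * ‖v‖₊) (fun t : ℝ => w (z + t • v)) := by
      refine hw.comp (LipschitzWith.of_dist_le_mul fun s t => ?_)
      rw [dist_add_left, dist_eq_norm, ← sub_smul, norm_smul, dist_eq_norm, mul_comm]
      rfl
    have hac := (hLip.lipschitzOnWith (s := uIcc 0 1)).absolutelyContinuousOnInterval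
    have hint := hac.integral_deriv_eq_sub
    have hle : ∫ t in (0:ℝ)..1, deriv (fun t : ℝ => w (z + t • v)) t ≤ ∫ t in (0:ℝ)..1, M := by
      refine intervalIntegral.integral_mono_ae_restrict zero_le_one
        hac.intervalIntegrable_deriv (by simp) ?_
      refine (ae_restrict_iff' measurableSet_Icc).2 ?_
      filter_upwards [hz] with t ht htI
      obtain ⟨hdiff, hb⟩ := hN _ ht
      have hmem : z + t • v ∈ U := by
        have := hUc hzU hzvU (a := 1 - t) (b := t) (by linarith [htI.2]) htI.1 (by ring)
        convert this using 1
        module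
      have hd : HasDerivAt (fun t : ℝ => w (z + t • v)) (⟪gradient w (z + t • v), v⟫) t := by
        have h1 := hdiff.hasFDerivAt
        have h2 : HasDerivAt (fun t : ℝ => z + t • v) v t := by
          simpa using ((hasDerivAt_id t).smul_const v).const_add z
        have e : (⟪gradient w (z + t • v), v⟫ : ℝ) = fderiv ℝ w (z + t • v) v := by simp
        rw [e]
        exact h1.comp_hasDerivAt t h2
      rw [hd.deriv]
      exact hb hmem
    rw [hint] at hle
    simpa using hle
  -- density
  by_contra hc
  push Not at hc
  have hopen : IsOpen {z : Ed d | z ∈ U ∧ z + v ∈ U ∧ M < w (z + v) - w z} := by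
    have c1 : Continuous fun z : Ed d => z + v := by fun_prop
    have c2 : Continuous fun z : Ed d => w (z + v) - w z :=
      (hw.continuous.comp c1).sub hw.continuous
    exact hU.inter ((hU.preimage c1).inter (isOpen_lt continuous_const c2))
  have hne : ({z : Ed d | z ∈ U ∧ z + v ∈ U ∧ M < w (z + v) - w z}).Nonempty := ⟨x, hx, hxv, hc⟩
  have hpos := hopen.measure_ne_zero volume hne
  apply hpos
  refine measure_mono_null ?_ (ae_iff.1 hz)
  rintro z ⟨h1, h2, h3⟩ h4
  exact absurd (h4 h1 h2) (not_le.2 h3)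

/-- discrete form of the gradient lies in Z -/
def SubZ {d : ℕ} (δ : ℝ) (Z : Ed d → Set (Ed d)) (w : Ed d → ℝ) : Prop :=
  ∀ y x x' : Ed d, dist x y < δ → dist x' y < δ → ∃ q ∈ Z y, w x' - w x ≤ ⟪q, x' - x⟫

lemma SubZ.of_ae {d : ℕ} {δ : ℝ} {Z : Ed d → Set (Ed d)} {w : Ed d → ℝ} {L : ℝ≥0}
    (hw : LipschitzWith L w) (hZ : ∀ y, IsCompact (Z y))
    (h : ∀ y, ∀ᵐ x, dist x y < δ → gradient w x ∈ Z y) : SubZ δ Z w := by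
  intro y x x' hx hx'
  have hne : (Z y).Nonempty := by
    have hpos : volume (Metric.ball y δ) ≠ 0 :=
      Metric.isOpen_ball.measure_ne_zero volume ⟨x, hx⟩
    by_contra hc
    rw [Set.not_nonempty_iff_eq_empty] at hc
    apply hpos
    refine measure_mono_null ?_ (ae_iff.1 (h y))
    intro z hz hz'
    have := hz' hz
    simp [hc] at this
  obtain ⟨q, hq, hmax⟩ := (hZ y).exists_isMaxOn hne
    (f := fun q => (⟪q, x' - x⟫ : ℝ)) (by fun_prop)
  refine ⟨q, hq, ?_⟩
  have := line_bound hw (U := Metric.ball y δ) Metric.isOpen_ball (convex_ball y δ)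
    (v := x' - x) (M := ⟪q, x' - x⟫) (x := x) ?_ hx (by simpa using hx')
  · simpa using this
  · filter_upwards [h y] with z hz hzb
    exact hmax (hz hzb)

lemma SubZ.gradient_mem {d : ℕ} {δ : ℝ} (hδ : 0 < δ) {Z : Ed d → Set (Ed d)} {w : Ed d → ℝ}
    (hZ : ∀ y, IsCompact (Z y)) (hZc : ∀ y, Convex ℝ (Z y)) (h : SubZ δ Z w) {y : Ed d}
    (hy : DifferentiableAt ℝ w y) : gradient w y ∈ Z y := by
  by_contra hc
  obtain ⟨f, u, hf1, hf2⟩ := geometric_hahn_banach_closed_point (hZc y) (hZ y).isClosed hc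
  set v := (InnerProductSpace.toDual ℝ (Ed d)).symm f with hv
  have hfv : ∀ q, f q = ⟪q, v⟫ := by
    intro q
    rw [real_inner_comm, hv, InnerProductSpace.toDual_symm_apply]
  have hd : HasDerivAt (fun t : ℝ => w (y + t • v)) (⟪gradient w y, v⟫) 0 := by
    have h1 := hy.hasFDerivAt
    have h2 : HasDerivAt (fun t : ℝ => y + t • v) v 0 := by
      simpa using ((hasDerivAt_id (0:ℝ)).smul_const v).const_add y
    have h1' : HasFDerivAt w (fderiv ℝ w y)
      ((fun t : ℝ => y + t • v) 0) := by simpa using h1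
    have e : (⟪gradient w y, v⟫ : ℝ) = fderiv ℝ w y v := by simp
    rw [e]
    exact h1'.comp_hasDerivAt (0:ℝ) h2
  have hlim := hd.hasDerivWithinAt (s := Set.Ioi 0)
  rw [hasDerivWithinAt_iff_tendsto_slope' (by simp)] at hlim
  have hle : (⟪gradient w y, v⟫ : ℝ) ≤ u := by
    refine le_of_tendsto hlim ?_
    have hnear : ∀ᶠ t : ℝ in 𝓝[>] 0, dist (y + t • v) y < δ := by
      have hcont : Continuous fun t : ℝ => dist (y + t • v) y := by fun_prop
      have := hcont.tendsto 0
      simp only [zero_smul, add_zero, dist_self] at this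
      exact (this.eventually_lt_const hδ).filter_mono nhdsWithin_le_nhds
    filter_upwards [hnear, self_mem_nhdsWithin] with t ht ht0
    have ht0 : 0 < t := ht0
    obtain ⟨q, hq, hle⟩ := h y y (y + t • v) (by simpa using hδ) ht
    have hqu := hf1 q hq
    rw [hfv] at hqu
    rw [slope_def_field]
    simp only [zero_smul, add_zero, sub_zero]
    rw [div_le_iff₀ ht0]
    have h3 : (⟪q, y + t • v - y⟫ : ℝ) = t * ⟪q, v⟫ := by
      rw [add_sub_cancel_left, inner_smul_right]
    nlinarith
  rw [hfv] at hf2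
  linarith

lemma iSup_sub_le {ι : Type*} [Nonempty ι] {a b : ι → ℝ} {c : ℝ}
    (hb : BddAbove (Set.range b)) (h : ∀ i, a i - b i ≤ c) : (⨆ i, a i) - (⨆ i, b i) ≤ c := by
  have : (⨆ i, a i) ≤ c + ⨆ i, b i := ciSup_le fun i => by
    have := le_ciSup hb i
    linarith [h i]
  linarith

lemma iInf_sub_le {ι : Type*} [Nonempty ι] {a b : ι → ℝ} {c : ℝ}
    (ha : BddBelow (Set.range a)) (h : ∀ i, a i - b i ≤ c) : (⨅ i, a i) - (⨅ i, b i) ≤ c := by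
  have : (⨅ i, a i) - c ≤ ⨅ i, b i := le_ciInf fun i => by
    have := ciInf_le ha i
    linarith [h i]
  linarith

/-- Lipschitz and `SubZ` -/
def Good {d : ℕ} (L : ℝ≥0) (δ : ℝ) (Z : Ed d → Set (Ed d)) (w : Ed d → ℝ) : Prop :=
  LipschitzWith L w ∧ SubZ δ Z w

lemma lip_of {d : ℕ} {L : ℝ≥0} {w : Ed d → ℝ} (h : ∀ x x', w x' - w x ≤ L * dist x' x) :
    LipschitzWith L w :=
  LipschitzWith.of_le_add_mul L fun x y => by linarith [h y x]

lemma lip_to {d : ℕ} {L : ℝ≥0} {w : Ed d → ℝ} (h : LipschitzWith L w) (x x' : Ed d) :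
    w x' - w x ≤ L * dist x' x := by
  have := h.dist_le_mul x' x
  rw [Real.dist_eq] at this
  linarith [le_abs_self (w x' - w x)]

lemma SubZ.max {d : ℕ} {δ : ℝ} {Z : Ed d → Set (Ed d)} {ι : Type*} [Nonempty ι]
    {u : ι → Ed d → ℝ} (hZ : ∀ y, IsCompact (Z y)) (hu : ∀ i, SubZ δ Z (u i))
    {y x x' : Ed d} (hx : dist x y < δ) (hx' : dist x' y < δ) :
    ∃ q ∈ Z y, ∀ i, u i x' - u i x ≤ ⟪q, x' - x⟫ := by
  obtain ⟨i0⟩ := ‹Nonempty ι›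
  obtain ⟨q0, hq0, -⟩ := hu i0 y x x' hx hx'
  obtain ⟨q, hq, hmax⟩ := (hZ y).exists_isMaxOn ⟨q0, hq0⟩
    (f := fun q => (⟪q, x' - x⟫ : ℝ)) (by fun_prop)
  refine ⟨q, hq, fun i => ?_⟩
  obtain ⟨q1, hq1, h1⟩ := hu i y x x' hx hx'
  exact h1.trans (hmax hq1)

lemma Good.iSup {d : ℕ} {L : ℝ≥0} {δ : ℝ} {Z : Ed d → Set (Ed d)} {ι : Type*} [Nonempty ι]
    {u : ι → Ed d → ℝ} (hZ : ∀ y, IsCompact (Z y)) (hu : ∀ i, Good L δ Z (u i))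
    (hb : ∀ y, BddAbove (Set.range fun i => u i y)) : Good L δ Z (fun y => ⨆ i, u i y) := by
  refine ⟨lip_of fun x x' => iSup_sub_le (hb x) fun i => lip_to (hu i).1 x x', ?_⟩
  intro y x x' hx hx'
  obtain ⟨q, hq, h⟩ := SubZ.max hZ (fun i => (hu i).2) hx hx'
  exact ⟨q, hq, iSup_sub_le (hb x) h⟩

lemma Good.iInf {d : ℕ} {L : ℝ≥0} {δ : ℝ} {Z : Ed d → Set (Ed d)} {ι : Type*} [Nonempty ι]
    {u : ι → Ed d → ℝ} (hZ : ∀ y, IsCompact (Z y)) (hu : ∀ i, Good L δ Z (u i))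
    (hb : ∀ y, BddBelow (Set.range fun i => u i y)) : Good L δ Z (fun y => ⨅ i, u i y) := by
  refine ⟨lip_of fun x x' => iInf_sub_le (hb x') fun i => lip_to (hu i).1 x x', ?_⟩
  intro y x x' hx hx'
  obtain ⟨q, hq, h⟩ := SubZ.max hZ (fun i => (hu i).2) hx hx'
  exact ⟨q, hq, iInf_sub_le (hb x') h⟩

lemma Good.add_const {d : ℕ} {L : ℝ≥0} {δ : ℝ} {Z : Ed d → Set (Ed d)} {u : Ed d → ℝ}
    (hu : Good L δ Z u) (c : ℝ) : Good L δ Z (fun y => u y + c) := by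
  refine ⟨lip_of fun x x' => by have := lip_to hu.1 x x'; simpa using this, ?_⟩
  intro y x x' hx hx'
  obtain ⟨q, hq, h⟩ := hu.2 y x x' hx hx'
  exact ⟨q, hq, by simpa using h⟩

def ClP (d : ℕ) (k m : ℕ) : Set (Ed d → ℝ) := {w | ∀ y, -(‖y‖ / (k + 1)) - m ≤ w y}
def ClM (d : ℕ) (k m : ℕ) : Set (Ed d → ℝ) := {w | ∀ y, w y ≤ ‖y‖ / (k + 1) + m}

lemma ClP_mono {d k m m' : ℕ} (h : m ≤ m') : ClP d k m ⊆ ClP d k m' := by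
  intro w hw y
  have h1 := hw y
  have h2 : (m : ℝ) ≤ m' := by exact_mod_cast h
  linarith

lemma ClM_mono {d k m m' : ℕ} (h : m ≤ m') : ClM d k m ⊆ ClM d k m' := by
  intro w hw y
  have h1 := hw y
  have h2 : (m : ℝ) ≤ m' := by exact_mod_cast h
  linarith

lemma SLplus_iff {d : ℕ} {w : Ed d → ℝ} :
    w ∈ SLplus d ↔ w ∈ LipFuns d ∧ ∀ k : ℕ, ∃ m : ℕ, w ∈ ClP d k m := by
  constructor
  · rintro ⟨⟨L, hL⟩, h⟩
    refine ⟨⟨L, hL⟩, fun k => ?_⟩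
    have hk : (0:ℝ) < k + 1 := by positivity
    obtain ⟨R, hR⟩ := h (1 / (k + 1)) (by positivity)
    obtain ⟨m, hm⟩ := exists_nat_ge (L * max R 1 + |w 0|)
    refine ⟨m, fun y => ?_⟩
    have hnn : 0 ≤ ‖y‖ / (k + 1) := by positivity
    rcases le_or_gt (max R 1) ‖y‖ with hy | hy
    · have h1 := hR y ((le_max_left _ _).trans hy)
      have hy0 : 0 < ‖y‖ := lt_of_lt_of_le one_pos ((le_max_right _ _).trans hy)
      rw [le_div_iff₀ hy0] at h1
      have : -(1 / ((k:ℝ) + 1)) * ‖y‖ = -(‖y‖ / (k + 1)) := by ring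
      have hm0 : (0:ℝ) ≤ m := by positivity
      linarith
    · have h1 := lip_to hL y 0
      rw [dist_zero_left] at h1
      have h2 : L * ‖y‖ ≤ L * max R 1 := by gcongr
      have := neg_abs_le (w 0)
      linarith
  · rintro ⟨hL, h⟩
    refine ⟨hL, fun ε hε => ?_⟩
    obtain ⟨k, hk⟩ := exists_nat_ge (2 / ε)
    obtain ⟨m, hm⟩ := h k
    refine ⟨2 * m / ε + 1, fun y hy => ?_⟩
    have hk0 : (0:ℝ) < k + 1 := by positivity
    have hy0 : 0 < ‖y‖ := lt_of_lt_of_le (by positivity) hy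
    rw [le_div_iff₀ hy0]
    have h1 := hm y
    have h2 : ‖y‖ / (k + 1) ≤ ε / 2 * ‖y‖ := by
      rw [div_le_iff₀ hk0]
      rw [div_le_iff₀ hε] at hk
      nlinarith
    have h3 : (m:ℝ) ≤ ε / 2 * ‖y‖ := by
      have : 2 * (m:ℝ) / ε ≤ ‖y‖ := by linarith
      rw [div_le_iff₀ hε] at this
      linarith
    linarith

lemma SLminus_iff_neg {d : ℕ} {w : Ed d → ℝ} :
    w ∈ SLminus d ↔ (fun y => - w y) ∈ SLplus d := by
  constructor
  · rintro ⟨⟨L, hL⟩, h⟩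
    refine ⟨⟨L, hL.neg⟩, fun ε hε => ?_⟩
    obtain ⟨R, hR⟩ := h ε hε
    exact ⟨R, fun y hy => by rw [neg_div]; linarith [hR y hy]⟩
  · rintro ⟨⟨L, hL⟩, h⟩
    refine ⟨⟨L, by have := hL.neg; simpa only [Pi.neg_def, neg_neg] using this⟩, fun ε hε => ?_⟩
    obtain ⟨R, hR⟩ := h ε hε
    exact ⟨R, fun y hy => by have := hR y hy; rw [neg_div] at this; linarith⟩

lemma SLminus_iff {d : ℕ} {w : Ed d → ℝ} :
    w ∈ SLminus d ↔ w ∈ LipFuns d ∧ ∀ k : ℕ, ∃ m : ℕ, w ∈ ClM d k m := by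
  rw [SLminus_iff_neg, SLplus_iff]
  have e1 : (fun y => - w y) ∈ LipFuns d ↔ w ∈ LipFuns d :=
    ⟨fun ⟨L, hL⟩ => ⟨L, by have := hL.neg; simpa only [Pi.neg_def, neg_neg] using this⟩, fun ⟨L, hL⟩ => ⟨L, hL.neg⟩⟩
  have e2 : ∀ k m, (fun y => - w y) ∈ ClP d k m ↔ w ∈ ClM d k m := fun k m =>
    ⟨fun h y => by have := h y; linarith, fun h y => by have := h y; linarith⟩
  simp only [e1, e2]

structure Adm (d : ℕ) (W : Set (Ed d → ℝ)) (Cl : ℕ → ℕ → Set (Ed d → ℝ)) : Prop where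
  lip : W ⊆ LipFuns d
  zero : (fun _ => 0) ∈ W
  shift : ∀ w ∈ W, ∀ z, (fun y => w (y + z)) ∈ W
  closed : ∀ k m, IsClosed (Cl k m)
  cl : ∀ w ∈ W, ∀ k, ∃ m, (fun y => w y - w 0) ∈ Cl k m
  comb : ∀ (L : ℝ≥0) (δ : ℝ) (Z : Ed d → Set (Ed d)), (∀ y, IsCompact (Z y)) →
    (∀ k, ∃ m, ∃ w, w 0 = 0 ∧ Good L δ Z w ∧ w ∈ Cl k m) → ∃ w ∈ W, Good L δ Z w

lemma lip_shift {d : ℕ} {w : Ed d → ℝ} (hw : w ∈ LipFuns d) (z : Ed d) :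
    (fun y => w (y + z)) ∈ LipFuns d := by
  obtain ⟨L, hL⟩ := hw
  exact ⟨L, lip_of fun x x' => by simpa using lip_to hL (x + z) (x' + z)⟩

lemma plus_shift {d : ℕ} {w : Ed d → ℝ} (hw : w ∈ SLplus d) (z : Ed d) :
    (fun y => w (y + z)) ∈ SLplus d := by
  rw [SLplus_iff] at *
  refine ⟨lip_shift hw.1 z, fun k => ?_⟩
  obtain ⟨m, hm⟩ := hw.2 k
  obtain ⟨m', hm'⟩ := exists_nat_ge (m + ‖z‖ / (k + 1))
  refine ⟨m', fun y => ?_⟩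
  have h1 := hm (y + z)
  have h2 : ‖y + z‖ / (k + 1) ≤ ‖y‖ / (k + 1) + ‖z‖ / (k + 1) := by
    rw [← add_div]; gcongr; exact norm_add_le y z
  show _ ≤ w (y + z)
  linarith

lemma minus_shift {d : ℕ} {w : Ed d → ℝ} (hw : w ∈ SLminus d) (z : Ed d) :
    (fun y => w (y + z)) ∈ SLminus d := by
  rw [SLminus_iff_neg] at *
  exact plus_shift hw z

lemma plus_cl {d : ℕ} {w : Ed d → ℝ} (hw : w ∈ SLplus d) (k : ℕ) :
    ∃ m, (fun y => w y - w 0) ∈ ClP d k m := by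
  obtain ⟨m, hm⟩ := (SLplus_iff.1 hw).2 k
  obtain ⟨m', hm'⟩ := exists_nat_ge (m + w 0)
  exact ⟨m', fun y => by have := hm y; linarith⟩

lemma minus_cl {d : ℕ} {w : Ed d → ℝ} (hw : w ∈ SLminus d) (k : ℕ) :
    ∃ m, (fun y => w y - w 0) ∈ ClM d k m := by
  obtain ⟨m, hm⟩ := (SLminus_iff.1 hw).2 k
  obtain ⟨m', hm'⟩ := exists_nat_ge (m - w 0)
  exact ⟨m', fun y => by have := hm y; linarith⟩

lemma ClP_closed {d k m : ℕ} : IsClosed (ClP d k m) := by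
  simp only [ClP, Set.ofPred_forall]
  exact isClosed_iInter fun y => isClosed_le continuous_const (continuous_apply y)

lemma ClM_closed {d k m : ℕ} : IsClosed (ClM d k m) := by
  simp only [ClM, Set.ofPred_forall]
  exact isClosed_iInter fun y => isClosed_le (continuous_apply y) continuous_const

lemma zero_lip {d : ℕ} : (fun _ => 0 : Ed d → ℝ) ∈ LipFuns d := ⟨0, LipschitzWith.const 0⟩

lemma zero_plus {d : ℕ} : (fun _ => 0 : Ed d → ℝ) ∈ SLplus d :=
  ⟨zero_lip, fun ε hε => ⟨0, fun y _ => by simp [hε.le]⟩⟩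

lemma zero_minus {d : ℕ} : (fun _ => 0 : Ed d → ℝ) ∈ SLminus d :=
  ⟨zero_lip, fun ε hε => ⟨0, fun y _ => by simp [hε.le]⟩⟩

lemma adm_lip (d : ℕ) : Adm d (LipFuns d) (fun _ _ => Set.univ) where
  lip := subset_rfl
  zero := zero_lip
  shift := fun w hw z => lip_shift hw z
  closed := fun _ _ => isClosed_univ
  cl := fun _ _ _ => ⟨0, trivial⟩
  comb := by
    intro L δ Z hZ h
    obtain ⟨m, w, -, hw, -⟩ := h 0
    exact ⟨w, ⟨L, hw.1⟩, hw⟩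

lemma adm_plus (d : ℕ) : Adm d (SLplus d) (ClP d) where
  lip := fun w hw => hw.1
  zero := zero_plus
  shift := fun w hw z => plus_shift hw z
  closed := fun _ _ => ClP_closed
  cl := fun w hw k => plus_cl hw k
  comb := by
    intro L δ Z hZ h
    choose m u h0 hu hm using h
    have hb : ∀ y, BddAbove (Set.range fun i => u i y) := by
      intro y
      refine ⟨L * dist y 0, ?_⟩
      rintro _ ⟨i, rfl⟩
      have := lip_to (hu i).1 0 y
      rw [h0] at this
      linarith
    have hG := Good.iSup hZ hu hb
    refine ⟨_, SLplus_iff.2 ⟨⟨L, hG.1⟩, fun k => ⟨m k, fun y => ?_⟩⟩, hG⟩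
    exact (hm k y).trans (le_ciSup (hb y) k)

lemma adm_minus (d : ℕ) : Adm d (SLminus d) (ClM d) where
  lip := fun w hw => hw.1
  zero := zero_minus
  shift := fun w hw z => minus_shift hw z
  closed := fun _ _ => ClM_closed
  cl := fun w hw k => minus_cl hw k
  comb := by
    intro L δ Z hZ h
    choose m u h0 hu hm using h
    have hb : ∀ y, BddBelow (Set.range fun i => u i y) := by
      intro y
      refine ⟨-(L * dist 0 y), ?_⟩
      rintro _ ⟨i, rfl⟩
      have := lip_to (hu i).1 y 0
      rw [h0] at this
      linarith
    have hG := Good.iInf hZ hu hb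
    refine ⟨_, SLminus_iff.2 ⟨⟨L, hG.1⟩, fun k => ⟨m k, fun y => ?_⟩⟩, hG⟩
    exact (ciInf_le (hb y) k).trans (hm k y)

lemma adm_scal (d : ℕ) : Adm d (Scal d) (fun k m => ClP d k m ∩ ClM d k m) where
  lip := fun w hw => hw.1.1
  zero := ⟨zero_plus, zero_minus⟩
  shift := fun w hw z => ⟨plus_shift hw.1 z, minus_shift hw.2 z⟩
  closed := fun _ _ => ClP_closed.inter ClM_closed
  cl := by
    intro w hw k
    obtain ⟨m1, h1⟩ := plus_cl hw.1 k
    obtain ⟨m2, h2⟩ := minus_cl hw.2 k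
    exact ⟨max m1 m2, ClP_mono (le_max_left _ _) h1, ClM_mono (le_max_right _ _) h2⟩
  comb := by
    intro L δ Z hZ h
    choose m u h0 hu hm using h
    let a : Ed d → ℕ → ℝ := fun x k => 2 * ‖x‖ / (k + 1) + 2 * m k
    let ψ : Ed d → ℝ := fun x => ⨅ k, a x k
    have ha : ∀ x k, 0 ≤ a x k := fun x k => by positivity
    have hab : ∀ x, BddBelow (Set.range (a x)) := fun x =>
      ⟨0, by rintro _ ⟨k, rfl⟩; exact ha x k⟩
    have hψ0 : ∀ x, 0 ≤ ψ x := fun x => le_ciInf (ha x)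
    have hψk : ∀ x k, ψ x ≤ a x k := fun x k => ciInf_le (hab x) k
    let g : Ed d → Ed d → ℝ := fun x y => ⨆ k, (u k y + - u k x)
    have hgb : ∀ x y, BddAbove (Set.range fun k => u k y + - u k x) := by
      intro x y
      refine ⟨L * dist y x, ?_⟩
      rintro _ ⟨i, rfl⟩
      have := lip_to (hu i).1 x y
      show u i y + - u i x ≤ _
      linarith
    have hg : ∀ x, Good L δ Z (g x) := fun x =>
      Good.iSup hZ (fun k => (hu k).add_const _) (hgb x)
    have hgl : ∀ x y, -(ψ x + ψ y) ≤ g x y := by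
      intro x y
      have key : ∀ k, -((‖x‖ + ‖y‖) / (k + 1) + 2 * m k) ≤ g x y := by
        intro k
        refine le_trans ?_ (le_ciSup (hgb x y) k)
        have h1 := (hm k).1 y
        have h2 := (hm k).2 x
        rw [add_div]
        linarith
      rcases le_total ‖x‖ ‖y‖ with hxy | hxy
      · have : -(g x y) ≤ ψ y := le_ciInf fun k => by
          have h1 := key k
          have h2 : (‖x‖ + ‖y‖) / ((k:ℝ) + 1) ≤ 2 * ‖y‖ / (k + 1) := by gcongr; linarith
          show _ ≤ 2 * ‖y‖ / (k + 1) + 2 * m k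
          linarith
        linarith [hψ0 x]
      · have : -(g x y) ≤ ψ x := le_ciInf fun k => by
          have h1 := key k
          have h2 : (‖x‖ + ‖y‖) / ((k:ℝ) + 1) ≤ 2 * ‖x‖ / (k + 1) := by gcongr; linarith
          show _ ≤ 2 * ‖x‖ / (k + 1) + 2 * m k
          linarith
        linarith [hψ0 y]
    have hlow : ∀ y x, -ψ y ≤ g x y + ψ x := fun y x => by linarith [hgl x y]
    have hb : ∀ y, BddBelow (Set.range fun x => g x y + ψ x) := fun y =>
      ⟨-ψ y, by rintro _ ⟨x, rfl⟩; exact hlow y x⟩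
    have hG := Good.iInf hZ (fun x => (hg x).add_const (ψ x)) hb
    have h1 : ∀ y, -ψ y ≤ ⨅ x, (g x y + ψ x) := fun y => le_ciInf (hlow y)
    have h2 : ∀ y, ⨅ x, (g x y + ψ x) ≤ ψ y := fun y => by
      refine (ciInf_le (hb y) y).trans ?_
      have : g y y = 0 := by simp [g]
      simp [this]
    have h3 : ∀ y (k : ℕ), ψ y ≤ ‖y‖ / (k + 1) + (2 * m (2 * k + 1) : ℕ) := fun y k => by
      refine (hψk y (2 * k + 1)).trans (le_of_eq ?_)
      simp only [a]
      push_cast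
      congr 1
      have : (k:ℝ) + 1 ≠ 0 := by positivity
      have : 2 * (k:ℝ) + 1 + 1 ≠ 0 := by positivity
      field_simp
      ring
    refine ⟨_, ⟨SLplus_iff.2 ⟨⟨L, hG.1⟩, fun k => ⟨2 * m (2 * k + 1), fun y => ?_⟩⟩,
      SLminus_iff.2 ⟨⟨L, hG.1⟩, fun k => ⟨2 * m (2 * k + 1), fun y => ?_⟩⟩⟩, hG⟩
    · linarith [h1 y, h3 y k]
    · exact (h2 y).trans (h3 y k)

open Set in
lemma convex_of_mid {d : ℕ} {S : Set (Ed d)} (hS : IsClosed S)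
    (h : ∀ p ∈ S, ∀ q ∈ S, (1/2 : ℝ) • (p + q) ∈ S) : Convex ℝ S := by
  rw [convex_iff_forall_pos]
  intro x hx y hy s t hs ht hst
  have hcont : Continuous fun r : ℝ => x + r • (y - x) := by fun_prop
  let T : Set ℝ := {r | x + r • (y - x) ∈ S}
  have hT : IsClosed T := hS.preimage hcont
  have hmid : ∀ a ∈ T, ∀ b ∈ T, (a + b) / 2 ∈ T := by
    intro a ha b hb
    have := h _ ha _ hb
    have e : x + ((a + b) / 2) • (y - x)
      = (1/2 : ℝ) • ((x + a • (y - x)) + (x + b • (y - x))) := by module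
    show _ ∈ S
    rw [e]; exact this
  have h0 : (0:ℝ) ∈ T := by simpa [T] using hx
  have h1 : (1:ℝ) ∈ T := by simpa [T] using hy
  obtain ⟨a, ⟨haT, ha⟩, hamax⟩ := (isCompact_Icc.inter_left hT : IsCompact (T ∩ Icc 0 t)).exists_isGreatest
    ⟨0, h0, le_rfl, ht.le⟩
  obtain ⟨b, ⟨hbT, hb⟩, hbmin⟩ := (isCompact_Icc.inter_left hT : IsCompact (T ∩ Icc t 1)).exists_isLeast
    ⟨1, h1, by linarith, le_rfl⟩
  have hm := hmid a haT b hbT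
  have htT : t ∈ T := by
    rcases le_total ((a + b) / 2) t with hc | hc
    · have := hamax ⟨hm, by linarith [ha.1, hb.1], hc⟩
      have : a = t := le_antisymm ha.2 (by linarith [hb.1])
      rwa [← this]
    · have := hbmin ⟨hm, hc, by linarith [ha.2, hb.2]⟩
      have : b = t := le_antisymm (by linarith [ha.2]) hb.1
      rwa [← this]
  have e : s • x + t • y = x + t • (y - x) := by
    have : s = 1 - t := by linarith
    rw [this]; module
  rw [e]; exact htT

def Zset {d : ℕ} (h : C(Ed d × Ed d, ℝ)) (p : Ed d) (μ : ℝ) (L : ℝ≥0) (y : Ed d) : Set (Ed d) :=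
  {q | ‖q‖ ≤ L ∧ h (p + q, y) ≤ μ}

lemma Zset_compact {d : ℕ} (h : C(Ed d × Ed d, ℝ)) (p : Ed d) (μ : ℝ) (L : ℝ≥0) (y : Ed d) :
    IsCompact (Zset h p μ L y) := by
  have e : Zset h p μ L y = Metric.closedBall 0 L ∩ {q | h (p + q, y) ≤ μ} := by
    ext q; simp [Zset]
  rw [e]
  refine (isCompact_closedBall _ _).inter_right (isClosed_le ?_ continuous_const)
  fun_prop

lemma proj_closed {X Y : Type*} [TopologicalSpace X] [TopologicalSpace Y] {K : Set Y}
    (hK : IsCompact K) {S : Set (X × Y)} (hS : IsClosed S) :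
    IsClosed {x | ∃ y ∈ K, (x, y) ∈ S} := by
  have := isCompact_iff_compactSpace.1 hK
  have hc : IsClosed {z : X × K | (z.1, (z.2 : Y)) ∈ S} := hS.preimage (by fun_prop)
  have := isClosedMap_fst_of_compactSpace _ hc
  convert this using 1
  ext x
  simp

def Bset (d : ℕ) (Cl : Set (Ed d → ℝ)) (p : Ed d) (μ : ℝ) (δ : ℝ) (L : ℝ≥0) :
    Set C(Ed d × Ed d, ℝ) :=
  {h | ∃ w : Ed d → ℝ, w 0 = 0 ∧ Good L δ (Zset h p μ L) w ∧ w ∈ Cl}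

lemma Bset_closed (d : ℕ) {Cl : Set (Ed d → ℝ)} (hCl : IsClosed Cl) (p : Ed d) (μ : ℝ) (δ : ℝ)
    (L : ℝ≥0) : IsClosed (Bset d Cl p μ δ L) := by
  let K : Set (Ed d → ℝ) := Set.pi Set.univ fun y => Set.Icc (-(L * ‖y‖)) (L * ‖y‖)
  have hK : IsCompact K := isCompact_univ_pi fun y => isCompact_Icc
  let S : Set (C(Ed d × Ed d, ℝ) × (Ed d → ℝ)) :=
    {z | z.2 0 = 0 ∧ (∀ x x', z.2 x' - z.2 x ≤ L * dist x' x) ∧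
      (∀ y x x', dist x y < δ → dist x' y < δ →
        ∃ q ∈ Metric.closedBall (0 : Ed d) L, (z, q) ∈ {a : (C(Ed d × Ed d, ℝ) × (Ed d → ℝ)) × Ed d |
          a.1.1 (p + a.2, y) ≤ μ ∧ a.1.2 x' - a.1.2 x ≤ ⟪a.2, x' - x⟫}) ∧ z.2 ∈ Cl}
  have hS : IsClosed S := by
    have hev : ∀ x : Ed d, Continuous fun z : C(Ed d × Ed d, ℝ) × (Ed d → ℝ) => z.2 x :=
      fun x => (continuous_apply x).comp continuous_snd
    refine (isClosed_eq (hev 0) continuous_const).inter (IsClosed.inter ?_ (IsClosed.inter ?_ ?_))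
    · change IsClosed {z : C(Ed d × Ed d, ℝ) × (Ed d → ℝ) |
        ∀ x x', z.2 x' - z.2 x ≤ L * dist x' x}
      simp only [Set.ofPred_forall]
      exact isClosed_iInter fun x => isClosed_iInter fun x' =>
        isClosed_le ((hev x').sub (hev x)) continuous_const
    · change IsClosed {z : C(Ed d × Ed d, ℝ) × (Ed d → ℝ) |
        ∀ y x x', dist x y < δ → dist x' y < δ →
        ∃ q ∈ Metric.closedBall (0 : Ed d) L, (z, q) ∈ {a : (C(Ed d × Ed d, ℝ) × (Ed d → ℝ)) × Ed d |
          a.1.1 (p + a.2, y) ≤ μ ∧ a.1.2 x' - a.1.2 x ≤ ⟪a.2, x' - x⟫}}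
      simp only [Set.ofPred_forall]
      refine isClosed_iInter fun y => isClosed_iInter fun x => isClosed_iInter fun x' =>
        isClosed_iInter fun _ => isClosed_iInter fun _ => ?_
      refine proj_closed (isCompact_closedBall _ _) ?_
      have c1 : Continuous fun a : (C(Ed d × Ed d, ℝ) × (Ed d → ℝ)) × Ed d => a.1.1 :=
        continuous_fst.comp continuous_fst
      have c2 : Continuous fun a : (C(Ed d × Ed d, ℝ) × (Ed d → ℝ)) × Ed d => (p + a.2, y) := by
        fun_prop
      have c3 : Continuous fun a : (C(Ed d × Ed d, ℝ) × (Ed d → ℝ)) × Ed d =>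
          (⟪a.2, x' - x⟫ : ℝ) := by fun_prop
      exact (isClosed_le (c1.eval c2) continuous_const).inter
        (isClosed_le (((hev x').sub (hev x)).comp continuous_fst) c3)
    · exact hCl.preimage continuous_snd
  have e : Bset d Cl p μ δ L = {h | ∃ w ∈ K, (h, w) ∈ S} := by
    ext h
    constructor
    · rintro ⟨w, h0, ⟨hL, hs⟩, hcl⟩
      refine ⟨w, ?_, h0, fun x x' => lip_to hL x x', ?_, hcl⟩
      · intro y _
        have h1 := lip_to hL y 0
        have h2 := lip_to hL 0 y
        rw [h0] at h1 h2
        simp only [dist_zero_left, dist_zero_right] at h1 h2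
        constructor <;> linarith
      · intro y x x' hx hx'
        obtain ⟨q, ⟨hq1, hq2⟩, hq3⟩ := hs y x x' hx hx'
        exact ⟨q, by simpa using hq1, hq2, hq3⟩
    · rintro ⟨w, -, h0, hL, hs, hcl⟩
      refine ⟨w, h0, ⟨lip_of hL, ?_⟩, hcl⟩
      intro y x x' hx hx'
      obtain ⟨q, hq1, hq2, hq3⟩ := hs y x x' hx hx'
      exact ⟨q, ⟨by simpa using hq1, hq2⟩, hq3⟩
  rw [e]
  exact proj_closed hK hS

/-- generic inf-sup quantity -/
def Fgen {d : ℕ} {Ω : Type*} (W : Set (Ed d → ℝ)) (H : Ed d → Ed d → Ω → ℝ) (p : Ed d) (ω : Ω) : ℝ :=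
  sInf {t | ∃ w ∈ W, t = essSup (fun y => H (p + gradient w y) y ω) volume}

lemma grad_le {d : ℕ} {w : Ed d → ℝ} {L : ℝ≥0} (hw : LipschitzWith L w) (y : Ed d) :
    ‖gradient w y‖ ≤ L := by
  have : ‖gradient w y‖ = ‖fderiv ℝ w y‖ := by
    rw [gradient, LinearIsometryEquiv.norm_map]
  rw [this]
  exact norm_fderiv_le_of_lipschitz ℝ hw

section
variable {d : ℕ} {Ω : Type*} {H : Ed d → Ed d → Ω → ℝ}

lemma ess_le_iff
    (hreg_bdd : ∀ R : ℝ, 0 < R → ∃ M : ℝ, ∀ (ω : Ω) (p y : Ed d), ‖p‖ ≤ R → |H p y ω| ≤ M)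
    {w : Ed d → ℝ} (hw : w ∈ LipFuns d) (p : Ed d) (ω : Ω) (c : ℝ) :
    essSup (fun y => H (p + gradient w y) y ω) volume ≤ c ↔
      ∀ᵐ y, H (p + gradient w y) y ω ≤ c := by
  obtain ⟨L, hL⟩ := hw
  obtain ⟨M, hM⟩ := hreg_bdd (‖p‖ + L + 1) (by positivity)
  have hb : ∀ y, |H (p + gradient w y) y ω| ≤ M := fun y => hM ω _ y <| by
    have := norm_add_le p (gradient w y)
    have := grad_le hL y
    linarith
  have h1 : IsBoundedUnder (· ≤ ·) (ae volume) (fun y => H (p + gradient w y) y ω) :=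
    isBoundedUnder_of ⟨M, fun y => (abs_le.1 (hb y)).2⟩
  have h2 : IsBoundedUnder (· ≥ ·) (ae volume) (fun y => H (p + gradient w y) y ω) :=
    isBoundedUnder_of ⟨-M, fun y => (abs_le.1 (hb y)).1⟩
  constructor
  · intro h
    filter_upwards [ae_le_essSup h1] with y hy
    exact hy.trans h
  · intro h
    exact essSup_le_of_ae_le c h h2.isCoboundedUnder_le
end

section
variable {d : ℕ} {Ω : Type*} {H : Ed d → Ed d → Ω → ℝ} 

lemma Fgen_lt_iff {W : Set (Ed d → ℝ)} (hW : W ⊆ LipFuns d) (hne : W.Nonempty)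
    (hreg_bdd : ∀ R : ℝ, 0 < R → ∃ M : ℝ, ∀ (ω : Ω) (p y : Ed d), ‖p‖ ≤ R → |H p y ω| ≤ M)
    (hcoer : ∀ M : ℝ, ∃ R : ℝ, ∀ (ω : Ω) (p y : Ed d), R ≤ ‖p‖ → M ≤ H p y ω)
    (p : Ed d) (ω : Ω) (μ : ℝ) :
    Fgen W H p ω < μ ↔ ∃ w ∈ W, ∃ μ' < μ, ∀ᵐ y, H (p + gradient w y) y ω ≤ μ' := by
  have hlow : ∃ m : ℝ, ∀ q y, m ≤ H q y ω := by
    obtain ⟨R, hR⟩ := hcoer 0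
    obtain ⟨M, hM⟩ := hreg_bdd (max R 1) (by positivity)
    refine ⟨min 0 (-M), fun q y => ?_⟩
    rcases le_total R ‖q‖ with h | h
    · exact (min_le_left _ _).trans (hR ω q y h)
    · exact (min_le_right _ _).trans (abs_le.1 (hM ω q y (h.trans (le_max_left _ _)))).1
  obtain ⟨m, hm⟩ := hlow
  have hbdd : BddBelow {t | ∃ w ∈ W, t = essSup (fun y => H (p + gradient w y) y ω) volume} := by
    refine ⟨m, ?_⟩
    rintro t ⟨w, hw, rfl⟩
    have h := (ess_le_iff hreg_bdd (hW hw) p ω _).1 le_rfl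
    obtain ⟨y, hy⟩ := h.exists
    exact (hm _ y).trans hy
  have hne' : {t | ∃ w ∈ W, t = essSup (fun y => H (p + gradient w y) y ω) volume}.Nonempty := by
    obtain ⟨w, hw⟩ := hne
    exact ⟨_, w, hw, rfl⟩
  rw [Fgen, csInf_lt_iff hbdd hne']
  constructor
  · rintro ⟨_, ⟨w, hw, rfl⟩, hlt⟩
    exact ⟨w, hw, _, hlt, (ess_le_iff hreg_bdd (hW hw) p ω _).1 le_rfl⟩
  · rintro ⟨w, hw, μ', hlt, h⟩
    exact ⟨_, ⟨w, hw, rfl⟩, lt_of_le_of_lt ((ess_le_iff hreg_bdd (hW hw) p ω _).2 h) hlt⟩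
end

section
variable {d : ℕ} {Ω : Type*} {H : Ed d → Ed d → Ω → ℝ}

lemma Fgen_cont {W : Set (Ed d → ℝ)} (hW : W ⊆ LipFuns d) (h0 : (fun _ => 0) ∈ W)
    (hreg_bdd : ∀ R : ℝ, 0 < R → ∃ M : ℝ, ∀ (ω : Ω) (p y : Ed d), ‖p‖ ≤ R → |H p y ω| ≤ M)
    (hreg_uc : ∀ R : ℝ, 0 < R → ∀ ε : ℝ, 0 < ε → ∃ δ : ℝ, 0 < δ ∧ ∀ (ω : Ω) (p p' y y' : Ed d),
      ‖p‖ ≤ R → ‖p'‖ ≤ R → ‖p - p'‖ < δ → ‖y - y'‖ < δ → |H p y ω - H p' y' ω| < ε)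
    (hcoer : ∀ M : ℝ, ∃ R : ℝ, ∀ (ω : Ω) (p y : Ed d), R ≤ ‖p‖ → M ≤ H p y ω)
    (ω : Ω) : Continuous fun p => Fgen W H p ω := by
  have hlt := fun p μ => Fgen_lt_iff hW ⟨_, h0⟩ hreg_bdd hcoer p ω μ
  rw [Metric.continuous_iff]
  intro p0 ε hε
  obtain ⟨M, hM⟩ := hreg_bdd (‖p0‖ + 1) (by positivity)
  obtain ⟨R, hR⟩ := hcoer (M + 2)
  obtain ⟨δ, hδ, huc⟩ := hreg_uc (max R 1 + 2) (by positivity) (ε / 2) (by positivity)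
  have hup : ∀ p, dist p p0 < 1 → Fgen W H p ω < M + 1 := by
    intro p hp
    refine (hlt p _).2 ⟨_, h0, M, by linarith, Eventually.of_forall fun y => ?_⟩
    refine (le_abs_self _).trans (hM ω _ y ?_)
    have hg := grad_le (LipschitzWith.const (0:ℝ) : LipschitzWith 0 (fun _ : Ed d => (0:ℝ))) y
    have h1 := norm_add_le p (gradient (fun _ : Ed d => (0:ℝ)) y)
    have h2 : ‖p‖ ≤ ‖p0‖ + ‖p - p0‖ := by
      have := norm_add_le p0 (p - p0)
      simpa using this
    rw [dist_eq_norm] at hp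
    simp only [NNReal.coe_zero] at hg
    linarith
  have key : ∀ p p', dist p p0 < 1 → dist p p' < min δ 1 →
      Fgen W H p' ω ≤ Fgen W H p ω + ε / 2 := by
    intro p p' hp hpp
    rw [dist_eq_norm] at hpp
    refine le_of_forall_gt fun μ hμ => ?_
    have hF : Fgen W H p ω < min (μ - ε / 2) (M + 1) := lt_min (by linarith) (hup p hp)
    obtain ⟨w, hw, μ', hμ', hae⟩ := (hlt p _).1 hF
    refine (hlt p' μ).2 ⟨w, hw, μ' + ε / 2, by linarith [hμ'.trans_le (min_le_left _ _)], ?_⟩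
    filter_upwards [hae] with y hy
    have h1 : ‖p + gradient w y‖ < R := by
      by_contra hc
      have := hR ω (p + gradient w y) y (not_lt.1 hc)
      linarith [hμ'.trans_le (min_le_right _ _)]
    have e : p' + gradient w y = (p + gradient w y) - (p - p') := by abel
    have h2 : ‖p' + gradient w y‖ ≤ max R 1 + 2 := by
      rw [e]
      have := norm_sub_le (p + gradient w y) (p - p')
      linarith [hpp.trans_le (min_le_right _ _), le_max_left R 1]
    have h3 := huc ω (p + gradient w y) (p' + gradient w y) y y
      (by linarith [le_max_left R 1]) h2
      (by simpa using hpp.trans_le (min_le_left _ _)) (by simpa using hδ)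
    linarith [(abs_lt.1 h3).1]
  refine ⟨min δ 1, by positivity, fun p hp => ?_⟩
  have k1 := key p p0 (hp.trans_le (min_le_right _ _)) hp
  have k2 := key p0 p (by simp) (by rwa [dist_comm])
  rw [Real.dist_eq, abs_lt]
  constructor <;> linarith

lemma Fgen_inv_aux {W : Set (Ed d → ℝ)} {Cl} (hA : Adm d W Cl)
    (τ : Ed d → Ω → Ω)
    (hHstat : ∀ (p y z : Ed d) (ω : Ω), H p y (τ z ω) = H p (y + z) ω)
    (hreg_bdd : ∀ R : ℝ, 0 < R → ∃ M : ℝ, ∀ (ω : Ω) (p y : Ed d), ‖p‖ ≤ R → |H p y ω| ≤ M)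
    (hcoer : ∀ M : ℝ, ∃ R : ℝ, ∀ (ω : Ω) (p y : Ed d), R ≤ ‖p‖ → M ≤ H p y ω)
    (p z : Ed d) (ω : Ω) : Fgen W H p (τ z ω) ≤ Fgen W H p ω := by
  have hlt := fun ω μ => Fgen_lt_iff hA.lip ⟨_, hA.zero⟩ hreg_bdd hcoer p ω μ
  refine le_of_forall_gt fun μ hμ => ?_
  obtain ⟨w, hw, μ', hμ', hae⟩ := (hlt ω _).1 hμ
  refine (hlt _ _).2 ⟨_, hA.shift w hw z, μ', hμ', ?_⟩
  have hmp := (measurePreserving_add_right (volume : Measure (Ed d)) z)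
  filter_upwards [hmp.quasiMeasurePreserving.ae hae] with y hy
  have e : gradient (fun y => w (y + z)) y = gradient w (y + z) := by
    simp only [gradient, fderiv_comp_add_right]
  rw [e, hHstat]
  exact hy

lemma Fgen_meas [MeasurableSpace Ω] {W : Set (Ed d → ℝ)} {Cl} (hA : Adm d W Cl)
    (hHmeas : Measurable fun x : Ed d × Ed d × Ω => H x.1 x.2.1 x.2.2)
    (hHcont : ∀ ω : Ω, Continuous fun q : Ed d × Ed d => H q.1 q.2 ω)
    (hreg_bdd : ∀ R : ℝ, 0 < R → ∃ M : ℝ, ∀ (ω : Ω) (p y : Ed d), ‖p‖ ≤ R → |H p y ω| ≤ M)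
    (hreg_uc : ∀ R : ℝ, 0 < R → ∀ ε : ℝ, 0 < ε → ∃ δ : ℝ, 0 < δ ∧ ∀ (ω : Ω) (p p' y y' : Ed d),
      ‖p‖ ≤ R → ‖p'‖ ≤ R → ‖p - p'‖ < δ → ‖y - y'‖ < δ → |H p y ω - H p' y' ω| < ε)
    (hcoer : ∀ M : ℝ, ∃ R : ℝ, ∀ (ω : Ω) (p y : Ed d), R ≤ ‖p‖ → M ≤ H p y ω)
    (hqc : ∀ (ω : Ω) (p q y : Ed d), H ((1/2 : ℝ) • (p + q)) y ω ≤ max (H p y ω) (H q y ω))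
    (p : Ed d) : Measurable fun ω => Fgen W H p ω := by
  let G : Ω → C(Ed d × Ed d, ℝ) := fun ω => ⟨fun q => H q.1 q.2 ω, hHcont ω⟩
  have hG : ∀ z, Measurable fun ω => G ω z := fun z =>
    hHmeas.comp (f := fun ω => (z.1, z.2, ω)) (by fun_prop)
  refine measurable_of_Iio fun μ => ?_
  have e : (fun ω => Fgen W H p ω) ⁻¹' Set.Iio μ = ⋃ r : {r : ℚ // (r : ℝ) < μ}, ⋃ n : ℕ, ⋃ L : ℕ,
      ⋂ k : ℕ, ⋃ m : ℕ, G ⁻¹' (Bset d (Cl k m) p (r.1 : ℝ) (1 / ((n : ℝ) + 1)) (L : ℝ≥0)) := by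
    ext ω
    simp only [Set.mem_preimage, Set.mem_iUnion, Set.mem_iInter, Set.mem_Iio]
    rw [Fgen_lt_iff hA.lip ⟨_, hA.zero⟩ hreg_bdd hcoer p ω μ]
    constructor
    · rintro ⟨w, hw, μ', hμ', hae⟩
      obtain ⟨r, hr1, hr2⟩ := exists_rat_btwn hμ'
      obtain ⟨L0, hL0⟩ := hA.lip hw
      obtain ⟨L, hLL⟩ := exists_nat_ge L0
      have hL : LipschitzWith (L : ℝ≥0) w := hL0.weaken hLL
      obtain ⟨δ, hδ, huc⟩ := hreg_uc (‖p‖ + L + 1) (by positivity) (r - μ') (by linarith)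
      obtain ⟨n, hn⟩ := exists_nat_one_div_lt hδ
      refine ⟨⟨r, hr2⟩, n, L, fun k => ?_⟩
      obtain ⟨m, hm⟩ := hA.cl w hw k
      have hg : Good (L : ℝ≥0) (1 / ((n : ℝ) + 1)) (Zset (G ω) p r (L : ℝ≥0)) w := by
        refine ⟨hL, SubZ.of_ae hL (fun y => Zset_compact _ _ _ _ _) fun y => ?_⟩
        filter_upwards [hae] with x hx hxy
        refine ⟨grad_le hL x, ?_⟩
        have hnorm : ‖p + gradient w x‖ ≤ ‖p‖ + L + 1 := by
          have h1 := norm_add_le p (gradient w x)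
          have h2 := grad_le hL x
          simp only [NNReal.coe_natCast] at h2
          linarith
        have h3 := huc ω (p + gradient w x) (p + gradient w x) y x hnorm hnorm (by simpa using hδ)
          (by rw [← dist_eq_norm, dist_comm]; linarith)
        show H (p + gradient w x) y ω ≤ r
        linarith [(abs_lt.1 h3).2]
      exact ⟨m, fun y => w y - w 0, by simp, by simpa [sub_eq_add_neg] using hg.add_const (- w 0), hm⟩
    · rintro ⟨⟨r, hr⟩, n, L, h⟩
      obtain ⟨w, hw, hg⟩ := hA.comb (L : ℝ≥0) (1 / ((n : ℝ) + 1)) (Zset (G ω) p r (L : ℝ≥0))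
        (fun y => Zset_compact _ _ _ _ _) h
      refine ⟨w, hw, r, hr, ?_⟩
      filter_upwards [hg.1.ae_differentiableAt] with y hy
      refine (SubZ.gradient_mem (by positivity) (fun y => Zset_compact _ _ _ _ _) (fun y => ?_)
        hg.2 hy).2
      refine convex_of_mid (Zset_compact _ _ _ _ _).isClosed ?_
      rintro a ⟨ha1, ha2⟩ b ⟨hb1, hb2⟩
      constructor
      · rw [norm_smul]
        have := norm_add_le a b
        simp only [one_div, norm_inv, Real.norm_ofNat]
        linarith
      · have h1 := hqc ω (p + a) (p + b) y
        have e : (1/2 : ℝ) • (p + a + (p + b)) = p + (1/2 : ℝ) • (a + b) := by module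
        rw [e] at h1
        exact h1.trans (max_le ha2 hb2)
  rw [e]
  exact MeasurableSet.iUnion fun r => MeasurableSet.iUnion fun n => MeasurableSet.iUnion fun L =>
    MeasurableSet.iInter fun k => MeasurableSet.iUnion fun m =>
      meas_closed G hG _ (Bset_closed d (hA.closed k m) _ _ _ _)

lemma Fgen_const [MeasurableSpace Ω] (P : Measure Ω) [IsProbabilityMeasure P]
    {W : Set (Ed d → ℝ)} {Cl} (hA : Adm d W Cl)
    (τ : Ed d → Ω → Ω)
    (hτgrp : ∀ x y : Ed d, τ (x + y) = τ x ∘ τ y)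
    (hτzero : τ 0 = id)
    (hτerg : ∀ A : Set Ω, MeasurableSet A → (∀ z : Ed d, τ z ⁻¹' A = A) → P A = 0 ∨ P A = 1)
    (hHmeas : Measurable fun x : Ed d × Ed d × Ω => H x.1 x.2.1 x.2.2)
    (hHstat : ∀ (p y z : Ed d) (ω : Ω), H p y (τ z ω) = H p (y + z) ω)
    (hHcont : ∀ ω : Ω, Continuous fun q : Ed d × Ed d => H q.1 q.2 ω)
    (hreg_bdd : ∀ R : ℝ, 0 < R → ∃ M : ℝ, ∀ (ω : Ω) (p y : Ed d), ‖p‖ ≤ R → |H p y ω| ≤ M)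
    (hreg_uc : ∀ R : ℝ, 0 < R → ∀ ε : ℝ, 0 < ε → ∃ δ : ℝ, 0 < δ ∧ ∀ (ω : Ω) (p p' y y' : Ed d),
      ‖p‖ ≤ R → ‖p'‖ ≤ R → ‖p - p'‖ < δ → ‖y - y'‖ < δ → |H p y ω - H p' y' ω| < ε)
    (hcoer : ∀ M : ℝ, ∃ R : ℝ, ∀ (ω : Ω) (p y : Ed d), R ≤ ‖p‖ → M ≤ H p y ω)
    (hqc : ∀ (ω : Ω) (p q y : Ed d), H ((1/2 : ℝ) • (p + q)) y ω ≤ max (H p y ω) (H q y ω)) :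
    ∃ c : Ed d → ℝ, ∀ᵐ ω ∂P, ∀ p, Fgen W H p ω = c p := by
  have hmeas := fun p => Fgen_meas hA hHmeas hHcont hreg_bdd hreg_uc hcoer hqc p
  have hinv : ∀ p z ω, Fgen W H p (τ z ω) = Fgen W H p ω := by
    intro p z ω
    refine le_antisymm (Fgen_inv_aux hA τ hHstat hreg_bdd hcoer p z ω) ?_
    have := Fgen_inv_aux hA τ hHstat hreg_bdd hcoer p (-z) (τ z ω)
    have e : τ (-z) (τ z ω) = ω := by
      have := congrFun (hτgrp (-z) z) ω
      rw [neg_add_cancel, hτzero] at this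
      exact this.symm
    rwa [e] at this
  have hconst : ∀ p, ∃ a : ℝ, ∀ᵐ ω ∂P, Fgen W H p ω = a := by
    intro p
    refine Filter.exists_eventuallyEq_const_of_forall_separating (l := ae P)
      (f := fun ω => Fgen W H p ω) MeasurableSet fun U hU => ?_
    have hAm : MeasurableSet {ω | Fgen W H p ω ∈ U} := hmeas p hU
    rcases hτerg _ hAm (fun z => by ext ω; simp [hinv]) with h | h
    · right
      exact measure_eq_zero_iff_ae_notMem.1 h
    · left
      exact (prob_compl_eq_zero_iff hAm).2 h
  choose a ha using hconst
  obtain ⟨D, hDc, hDd⟩ := TopologicalSpace.exists_countable_dense (Ed d)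
  have hall : ∀ᵐ ω ∂P, ∀ p ∈ D, Fgen W H p ω = a p :=
    (ae_ball_iff hDc).2 fun p _ => ha p
  obtain ⟨ω0, hω0⟩ := hall.exists
  refine ⟨fun p => Fgen W H p ω0, ?_⟩
  filter_upwards [hall] with ω hω p
  have := Continuous.ext_on hDd
    (Fgen_cont hA.lip hA.zero hreg_bdd hreg_uc hcoer ω)
    (Fgen_cont hA.lip hA.zero hreg_bdd hreg_uc hcoer ω0)
    (fun p hp => (hω p hp).trans (hω0 p hp).symm)
  exact congrFun this p
end

/-- the quantities H̄₊, H̄₋, Ĥ, H̄* are a.s. deterministic. -/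
theorem statement_12
    (d : ℕ) (hd : 0 < d)
    {Ω : Type*} [MeasurableSpace Ω] (P : Measure Ω) [IsProbabilityMeasure P]
    (τ : Ed d → Ω → Ω)
    (hτmeas : ∀ y : Ed d, Measurable (τ y))
    (hτmp : ∀ y : Ed d, MeasurePreserving (τ y) P P)
    (hτgrp : ∀ x y : Ed d, τ (x + y) = τ x ∘ τ y)
    (hτzero : τ 0 = id)
    (hτerg : ∀ A : Set Ω, MeasurableSet A → (∀ z : Ed d, τ z ⁻¹' A = A) → P A = 0 ∨ P A = 1)
    (H : Ed d → Ed d → Ω → ℝ)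
    (hHmeas : Measurable fun x : Ed d × Ed d × Ω => H x.1 x.2.1 x.2.2)
    (hHstat : ∀ (p y z : Ed d) (ω : Ω), H p y (τ z ω) = H p (y + z) ω)
    (hHcont : ∀ ω : Ω, Continuous fun q : Ed d × Ed d => H q.1 q.2 ω)
    (hreg_bdd : ∀ R : ℝ, 0 < R → ∃ M : ℝ, ∀ (ω : Ω) (p y : Ed d), ‖p‖ ≤ R → |H p y ω| ≤ M)
    (hreg_uc : ∀ R : ℝ, 0 < R → ∀ ε : ℝ, 0 < ε → ∃ δ : ℝ, 0 < δ ∧ ∀ (ω : Ω) (p p' y y' : Ed d),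
      ‖p‖ ≤ R → ‖p'‖ ≤ R → ‖p - p'‖ < δ → ‖y - y'‖ < δ → |H p y ω - H p' y' ω| < ε)
    (hcoer : ∀ M : ℝ, ∃ R : ℝ, ∀ (ω : Ω) (p y : Ed d), R ≤ ‖p‖ → M ≤ H p y ω)
    (hqc : ∀ (ω : Ω) (p q y : Ed d), H ((1/2 : ℝ) • (p + q)) y ω ≤ max (H p y ω) (H q y ω))
    (Λ : ℝ → ℝ → ℝ)
    (hΛcont : Continuous fun m : ℝ × ℝ => Λ m.1 m.2)
    (hΛmono : ∀ a b a' b' : ℝ, a ≤ a' → b ≤ b' → Λ a b ≤ Λ a' b')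
    (hΛstrict : ∀ a b : ℝ, a ≠ b → Λ a b < max a b)
    (hsqc : ∀ (ω : Ω) (p q y : Ed d), H ((1/2 : ℝ) • (p + q)) y ω ≤ Λ (H p y ω) (H q y ω))
    :
    ∃ (Hp Hm Hh : Ed d → ℝ) (Hs : ℝ) (Ωhat : Set Ω),
      MeasurableSet Ωhat ∧ P Ωhat = 1 ∧
      ∀ ω ∈ Ωhat, ∀ p : Ed d,
        HbarPlusOm d H p ω = Hp p ∧ HbarMinusOm d H p ω = Hm p ∧
        HhatOm d H p ω = Hh p ∧ HstarOm d H ω = Hs := by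
  obtain ⟨c1, h1⟩ := Fgen_const P (adm_plus d) τ hτgrp hτzero hτerg hHmeas hHstat hHcont hreg_bdd hreg_uc hcoer hqc
  obtain ⟨c2, h2⟩ := Fgen_const P (adm_minus d) τ hτgrp hτzero hτerg hHmeas hHstat hHcont hreg_bdd hreg_uc hcoer hqc
  obtain ⟨c3, h3⟩ := Fgen_const P (adm_scal d) τ hτgrp hτzero hτerg hHmeas hHstat hHcont hreg_bdd hreg_uc hcoer hqc
  obtain ⟨c4, h4⟩ := Fgen_const P (adm_lip d) τ hτgrp hτzero hτerg hHmeas hHstat hHcont hreg_bdd hreg_uc hcoer hqc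
  obtain ⟨N, hNsub, hNm, hN0⟩ :=
    exists_measurable_superset_of_null (ae_iff.1 (h1.and (h2.and (h3.and h4))))
  refine ⟨c1, c2, c3, c4 0, Nᶜ, hNm.compl, (prob_compl_eq_one_iff hNm).2 hN0, fun ω hω p => ?_⟩
  have hg := by_contra fun hc => hω (hNsub hc)
  obtain ⟨g1, g2, g3, g4⟩ := hg
  refine ⟨g1 p, g2 p, g3 p, ?_⟩
  have := g4 0
  simpa only [Fgen, HstarOm, zero_add] using this
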